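/- arXiv:2010.04583 — 2 statements merged into one kernel-verified Lean document; each statement's English description precedes it below -/
import Mathlib

section
/- There exists a constant C > 0 such that for every integer t ≥ 1 we have |Σ_{x∈ℤ} a₁(x,t)² − 1/(2√2)| ≤ C/√t. In other words, the probability of direction reversal Σ_{x∈ℤ} a₁(x,t)² equals 1/(2√2) + O(1/√t). -/
open scoped BigOperators

/-- The final x-coordinate of a checker path from `(0,0)` encoded by its sequence of moves
(`true` = move `(1,1)`, `false` = move `(-1,1)`). -/
def moveEndpoint {n : ℕ} (d : Fin n → Bool) : ℤ :=
  ∑ k, (if d k then (1 : ℤ) else -1)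

/-- The number of turns of a checker path encoded by its sequence of moves. -/
def nturns {n : ℕ} (d : Fin n → Bool) : ℕ :=
  ((List.ofFn d).zip (List.ofFn d).tail).countP fun p => p.1 != p.2

/-- Checker paths from `(0,0)` to `(x,t)` whose first step is to `(1,1)`,
encoded by their sequences of moves. -/
def cpaths (x t : ℤ) : Finset (Fin t.toNat → Bool) :=
  Finset.univ.filter fun d => moveEndpoint d = x ∧ (List.ofFn d).headI = true

/-- Feynman checkers amplitude `a(x,t) = 2^((1-t)/2) * i * ∑ₛ (-i)^turns(s)`. -/
noncomputable def a (x t : ℤ) : ℂ :=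
  (Real.sqrt 2 : ℂ) ^ (1 - t) * Complex.I * ∑ d ∈ cpaths x t, (-Complex.I) ^ nturns d

/-- Unnormalised real amplitude after `n + 1` steps. -/
noncomputable def vv : ℕ → ℤ → ℝ
  | 0, _ => 0
  | 1, x => if x = 0 then 1 else 0
  | (n + 2), x => vv (n + 1) (x - 1) + vv (n + 1) (x + 1) - 2 * vv n x

lemma vv_zero (x : ℤ) : vv 0 x = 0 := by simp [vv]
lemma vv_one (x : ℤ) : vv 1 x = if x = 0 then 1 else 0 := by simp [vv]
lemma vv_add_two (n : ℕ) (x : ℤ) :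
    vv (n + 2) x = vv (n + 1) (x - 1) + vv (n + 1) (x + 1) - 2 * vv n x := by
  rw [vv]

/-- sign of a move -/
def mv (b : Bool) : ℤ := if b then 1 else -1

/-- path sum with first step `b` -/
noncomputable def zz (b : Bool) (n : ℕ) (x : ℤ) : ℂ :=
  ∑ d : Fin n → Bool, if moveEndpoint (Fin.cons b d : Fin (n + 1) → Bool) = x then
    (-Complex.I) ^ nturns (Fin.cons b d : Fin (n + 1) → Bool) else 0

lemma moveEndpoint_cons (b : Bool) {n : ℕ} (d : Fin n → Bool) :
    moveEndpoint (Fin.cons b d : Fin (n + 1) → Bool) = mv b + moveEndpoint d := by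
  simp [moveEndpoint, Fin.sum_univ_succ, mv]

lemma nturns_cons_cons (b c : Bool) {n : ℕ} (d : Fin n → Bool) :
    nturns (Fin.cons b (Fin.cons c d : Fin (n + 1) → Bool) : Fin (n + 2) → Bool)
      = nturns (Fin.cons c d : Fin (n + 1) → Bool) + (if b = c then 0 else 1) := by
  unfold nturns
  simp only [List.ofFn_succ, Fin.cons_zero, Fin.cons_succ, List.tail_cons, List.zip_cons_cons,
    List.countP_cons]
  cases b <;> cases c <;> simp

lemma sum_cons {n : ℕ} (f : (Fin (n + 1) → Bool) → ℂ) :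
    ∑ d, f d = ∑ d : Fin n → Bool, f (Fin.cons true d : Fin (n + 1) → Bool)
      + ∑ d : Fin n → Bool, f (Fin.cons false d : Fin (n + 1) → Bool) := by
  rw [← (Fin.consEquiv (fun _ : Fin (n + 1) => Bool)).sum_comp, Fintype.sum_prod_type,
    Fintype.sum_bool]
  rfl

lemma zz_zero (b : Bool) (x : ℤ) : zz b 0 x = if mv b = x then 1 else 0 := by
  unfold zz
  rw [Fintype.sum_unique, moveEndpoint_cons]
  simp [moveEndpoint, nturns]

lemma zz_succ (b : Bool) (n : ℕ) (x : ℤ) :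
    zz b (n + 1) x = zz b n (x - mv b) + (-Complex.I) * zz (!b) n (x - mv b) := by
  have key : ∀ c : Bool, (∑ d : Fin n → Bool,
      if moveEndpoint (Fin.cons b (Fin.cons c d : Fin (n + 1) → Bool) : Fin (n + 2) → Bool) = x then
        (-Complex.I) ^ nturns
          (Fin.cons b (Fin.cons c d : Fin (n + 1) → Bool) : Fin (n + 2) → Bool) else 0)
      = (if b = c then 1 else -Complex.I) * zz c n (x - mv b) := by
    intro c
    unfold zz
    rw [Finset.mul_sum]
    refine Finset.sum_congr rfl fun d _ => ?_
    rw [moveEndpoint_cons b, nturns_cons_cons]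
    have : (mv b + moveEndpoint (Fin.cons c d : Fin (n + 1) → Bool) = x) ↔
      (moveEndpoint (Fin.cons c d : Fin (n + 1) → Bool) = x - mv b) := by
      constructor <;> intro h <;> linarith
    simp only [this]
    split_ifs <;> simp [pow_succ, mul_comm]
  rw [zz, sum_cons, key, key]
  cases b <;> simp <;> ring

lemma zz_eq (n : ℕ) : ∀ x : ℤ,
    zz true n x = vv (n + 1) (x - 1) - vv n x - Complex.I * vv n x ∧
    zz false n x = vv (n + 1) (x + 1) - vv n x - Complex.I * vv n x := by
  induction n with
  | zero =>
    intro x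
    simp only [zz_zero, vv_zero, vv_one, zero_add, mv]
    constructor
    · have : (1 = x) ↔ (x - 1 = 0) := by omega
      simp [this]; split_ifs <;> simp
    · have : (-1 = x) ↔ (x + 1 = 0) := by omega
      simp [this]; split_ifs <;> simp
  | succ n ih =>
    intro x
    have h1 := (ih (x - 1)).1
    have h2 := (ih (x - 1)).2
    have h3 := (ih (x + 1)).1
    have h4 := (ih (x + 1)).2
    have I2 := Complex.I_sq
    constructor
    · rw [zz_succ]
      simp only [mv, Bool.not_true, if_true]
      rw [h1, h2, vv_add_two n]
      push_cast
      rw [show x - 1 + 1 = x by ring]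
      linear_combination (vv n (x - 1) : ℂ) * I2
    · rw [zz_succ]
      simp only [mv, Bool.not_false, Bool.false_eq_true, if_false, sub_neg_eq_add]
      rw [h3, h4, vv_add_two n]
      push_cast
      rw [show x + 1 - 1 = x by ring]
      linear_combination (vv n (x + 1) : ℂ) * I2

lemma a_eq (n : ℕ) (x : ℤ) :
    a x ((n + 1 : ℕ) : ℤ) = (Real.sqrt 2 : ℂ) ^ (1 - ((n + 1 : ℕ) : ℤ)) * Complex.I * zz true n x := by
  have h : cpaths x ((n + 1 : ℕ) : ℤ) = (Finset.univ : Finset (Fin (n + 1) → Bool)).filter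
    (fun d => moveEndpoint d = x ∧ (List.ofFn d).headI = true) := rfl
  have h2 : ∑ d ∈ cpaths x ((n + 1 : ℕ) : ℤ), (-Complex.I) ^ nturns d = 
     ∑ d ∈ (Finset.univ : Finset (Fin (n + 1) → Bool)).filter
    (fun d => moveEndpoint d = x ∧ (List.ofFn d).headI = true), (-Complex.I) ^ nturns d := rfl
  unfold a
  rw [h2, Finset.sum_filter, sum_cons]
  simp [zz]

lemma a_re (n : ℕ) (x : ℤ) : (a x ((n + 1 : ℕ) : ℤ)).re ^ 2 = vv n x ^ 2 / 2 ^ n := by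
  have hr : a x ((n + 1 : ℕ) : ℤ) = (((Real.sqrt 2)⁻¹ ^ n : ℝ) : ℂ) *
      ((vv n x : ℝ) + ((vv (n + 1) (x - 1) - vv n x : ℝ) : ℂ) * Complex.I) := by
    rw [a_eq, (zz_eq n x).1]
    have : (1 - ((n + 1 : ℕ) : ℤ)) = -(n : ℤ) := by push_cast; ring
    rw [this, zpow_neg, zpow_natCast]
    push_cast
    rw [inv_pow]
    linear_combination (-((Real.sqrt 2 : ℂ) ^ n)⁻¹ * vv n x) * Complex.I_sq
  rw [hr, Complex.re_ofReal_mul]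
  simp only [Complex.add_re, Complex.ofReal_re, Complex.mul_re, Complex.I_re, Complex.I_im,
    Complex.ofReal_im, mul_zero, zero_mul, sub_zero, add_zero]
  rw [mul_pow, ← pow_mul, mul_comm n 2, pow_mul, inv_pow, Real.sq_sqrt (by norm_num), inv_pow]
  ring

lemma vv_supp (n : ℕ) : ∀ x : ℤ, (n : ℤ) < |x| → vv n x = 0 := by
  induction n using Nat.twoStepInduction with
  | zero => intro x _; exact vv_zero x
  | one =>
    intro x hx
    rw [vv_one, if_neg]
    rintro rfl
    simp at hx
  | more n h0 h1 =>
    intro x hx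
    push_cast at hx h1
    have e : ∀ y : ℤ, (|x| - 1 ≤ |y|) → vv (n + 1) y = 0 := fun y hy => h1 y (by linarith)
    rw [vv_add_two, e, e, h0 x (by linarith)]
    · ring
    · have := abs_sub_abs_le_abs_sub x (-1); simp at this; linarith
    · have := abs_sub_abs_le_abs_sub x 1; simp at this; linarith

lemma vv_summ (m : ℕ) (f : ℤ → ℝ) (c : ℤ) : Summable (fun x => vv m (x + c) * f x) := by
  apply summable_of_hasFiniteSupport
  apply (Set.finite_Icc (-(m : ℤ) - c) (m - c)).subset
  intro x hx
  by_contra h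
  apply hx
  simp only
  rw [vv_supp m (x + c), zero_mul]
  by_contra h'
  apply h
  have := abs_le.1 (not_lt.1 h')
  constructor <;> linarith

lemma vv_summ' (m : ℕ) (f : ℤ → ℝ) : Summable (fun x => vv m x * f x) := by
  simpa using vv_summ m f 0

lemma vv_shift (m n : ℕ) (c : ℤ) :
    ∑' x, vv m (x + c) * vv n x = ∑' x, vv m x * vv n (x - c) := by
  rw [← (Equiv.addRight c).tsum_eq (fun x => vv m x * vv n (x - c))]
  simp

/-- bilinear sums -/
noncomputable def BB (m n : ℕ) : ℝ := ∑' x, vv m x * vv n x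

lemma BB_comm (m n : ℕ) : BB m n = BB n m := by
  unfold BB; congr 1; ext x; ring

lemma BB_step (m n : ℕ) : BB (m + 2) n + 2 * BB m n =
    ∑' x, vv (m + 1) (x - 1) * vv n x + ∑' x, vv (m + 1) (x + 1) * vv n x := by
  have h1 := (vv_summ (m + 1) (vv n) (-1))
  have h2 := (vv_summ (m + 1) (vv n) 1)
  have h3 := (vv_summ' m (vv n))
  have h4 := (vv_summ' (m + 2) (vv n))
  simp only [← sub_eq_add_neg] at h1
  unfold BB
  rw [← tsum_mul_left, ← h4.tsum_add (h3.mul_left 2), ← h1.tsum_add h2]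
  congr 1; ext x
  rw [vv_add_two]; ring

lemma BB_exch (m n : ℕ) : BB (m + 2) (n + 1) + 2 * BB m (n + 1) =
    BB (m + 1) (n + 2) + 2 * BB (m + 1) n := by
  rw [BB_step, BB_comm (m + 1) (n + 2), BB_comm (m + 1) n, BB_step, vv_shift]
  have := vv_shift (m + 1) (n + 1) (-1)
  simp only [← sub_eq_add_neg, sub_neg_eq_add] at this
  rw [this, add_comm]
  congr 1 <;> (congr 1; ext x; ring)

lemma BB_main (m : ℕ) : ∀ n, BB (m + 1) (n + 1) - 2 * BB m n = vv (m + n + 1) 0 := by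
  induction m with
  | zero =>
    intro n
    have : BB 0 n = 0 := by simp [BB, vv_zero]
    rw [this]
    unfold BB
    rw [tsum_eq_single 0]
    · simp [vv_one]
    · intro x hx
      simp [vv_one, hx]
  | succ m ih =>
    intro n
    have h1 := ih (n + 1)
    have h2 := BB_exch m n
    rw [show m + 1 + n + 1 = m + (n + 1) + 1 by ring]
    linarith

lemma vv_deriv (n : ℕ) : ∀ x : ℤ, (x : ℝ) * (vv (n + 2) x - 2 * vv n x)
    = (n + 1) * (vv (n + 1) (x - 1) - vv (n + 1) (x + 1)) := by
  induction n using Nat.twoStepInduction with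
  | zero =>
    intro x
    simp only [vv_add_two, zero_add, vv_zero, vv_one]
    by_cases h : x = 1
    · subst h; norm_num
    · by_cases h' : x = -1
      · subst h'; norm_num
      · rw [if_neg (by omega), if_neg (by omega)]; simp
  | one =>
    intro x
    simp only [vv_add_two, zero_add, vv_zero, vv_one, Nat.reduceAdd]
    by_cases h : x = 2
    · subst h; norm_num
    · by_cases h' : x = -2
      · subst h'; norm_num
      · rw [show x - 1 - 1 = x - 2 by ring, show x + 1 + 1 = x + 2 by ring,
          show x - 1 + 1 = x by ring, show x + 1 - 1 = x by ring]
        rw [if_neg (show ¬ x - 2 = 0 by omega), if_neg (show ¬ x + 2 = 0 by omega)]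
        by_cases h0 : x = 0
        · subst h0; norm_num
        · simp [h0]
  | more n h0 h1 =>
    intro x
    have a1 := h1 (x - 1)
    have a2 := h1 (x + 1)
    have a0 := h0 x
    have e1 := vv_add_two (n + 2) x
    have e0 := vv_add_two n x
    have f1 := vv_add_two (n + 1) (x - 1)
    have f2 := vv_add_two (n + 1) (x + 1)
    push_cast at a1 a2 ⊢
    simp only [show n + 1 + 2 = n + 3 by ring, show n + 1 + 1 = n + 2 by ring,
      show n + 2 + 2 = n + 4 by ring, show n + 2 + 1 = n + 3 by ring,
      show x - 1 + 1 = x by ring, show x + 1 - 1 = x by ring] at *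
    linear_combination a1 + a2 - 2 * a0 + (x : ℝ) * e1 - 2 * (x : ℝ) * e0
      - ((n : ℝ) + 2) * f1 + ((n : ℝ) + 2) * f2

lemma vv_rec (n : ℕ) : ((n : ℝ) + 4) * vv (n + 5) 0 = - (4 * (n + 2)) * vv (n + 1) 0 := by
  have h1 := vv_deriv (n + 2) 1
  have h2 := vv_deriv (n + 2) (-1)
  have g5 := vv_add_two (n + 3) 0
  have g4 := vv_add_two (n + 2) 1
  have g4' := vv_add_two (n + 2) (-1)
  have g3 := vv_add_two (n + 1) 0
  push_cast at h1 h2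
  norm_num [add_assoc] at h1 h2 g5 g4 g4' g3
  linear_combination h1 - h2 + g5 - 2 * g3 + ((n : ℝ) + 3) * (g5 + 2 * g3 + g4 + g4')

/-- normalised increments -/
noncomputable def EE (n : ℕ) : ℝ := vv (2 * n + 1) 0 / 2 ^ n

lemma EE_rec (m : ℕ) : ((m : ℝ) + 2) * EE (m + 2) = -(m + 1) * EE m := by
  have h := vv_rec (2 * m)
  unfold EE
  rw [show 2 * (m + 2) + 1 = 2 * m + 5 by ring, pow_add]
  push_cast at h
  have : (2 : ℝ) ^ m ≠ 0 := by positivity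
  field_simp
  linear_combination h / 2

/-- `centralBinom k / 4 ^ k` -/
noncomputable def bb : ℕ → ℝ
  | 0 => 1
  | (k + 1) => bb k * (2 * k + 1) / (2 * k + 2)

lemma bb_succ (k : ℕ) : (2 * (k : ℝ) + 2) * bb (k + 1) = (2 * k + 1) * bb k := by
  rw [bb]
  have : (2 * (k : ℝ) + 2) ≠ 0 := by positivity
  field_simp

lemma bb_nonneg (k : ℕ) : 0 ≤ bb k := by
  induction k with
  | zero => simp [bb]
  | succ k ih => rw [bb]; positivity

lemma bb_sq (k : ℕ) : bb k ^ 2 * (2 * k + 1) ≤ 1 := by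
  induction k with
  | zero => simp [bb]
  | succ k ih =>
    have h : bb (k + 1) ^ 2 * (2 * ((k + 1 : ℕ) : ℝ) + 1) =
        (bb k ^ 2 * (2 * k + 1)) * ((2 * k + 1) * (2 * k + 3) / (2 * k + 2) ^ 2) := by
      rw [bb]; push_cast; field_simp; ring
    rw [h]
    apply mul_le_one₀ ih (by positivity)
    rw [div_le_one (by positivity)]
    nlinarith

lemma bb_le (k : ℕ) : bb k ≤ 1 / Real.sqrt (2 * k + 1) := by
  have hp : (0 : ℝ) < 2 * k + 1 := by positivity
  rw [le_div_iff₀ (Real.sqrt_pos.2 hp)]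
  have h := bb_sq k
  have : (bb k * Real.sqrt (2 * k + 1)) ^ 2 ≤ 1 ^ 2 := by
    rw [mul_pow, Real.sq_sqrt hp.le]; simpa using h
  exact le_of_sq_le_sq this
where
  le_of_sq_le_sq {x : ℝ} (h : x ^ 2 ≤ 1 ^ 2) : x ≤ 1 := by nlinarith

lemma EE_even_odd (k : ℕ) : EE (2 * k) = (-1) ^ k * bb k ∧ EE (2 * k + 1) = 0 := by
  induction k with
  | zero =>
    constructor
    · simp [EE, vv_one, bb]
    · simp [EE, vv_add_two, vv_one, vv_zero]; norm_num
  | succ k ih =>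
    have h1 := EE_rec (2 * k)
    have h2 := EE_rec (2 * k + 1)
    rw [ih.1] at h1
    rw [ih.2] at h2
    push_cast at h1 h2
    have hb := bb_succ k
    constructor
    · have hp : (2 * (k : ℝ) + 2) ≠ 0 := by positivity
      apply mul_left_cancel₀ hp
      rw [show 2 * (k + 1) = 2 * k + 2 by ring, pow_succ]
      linear_combination h1 + (-1) ^ k * hb
    · have hp : (2 * (k : ℝ) + 1 + 2) ≠ 0 := by positivity
      apply mul_left_cancel₀ hp
      rw [show 2 * (k + 1) + 1 = 2 * k + 1 + 2 by ring]
      linear_combination h2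

/-- normalised probabilities -/
noncomputable def PP (n : ℕ) : ℝ := BB n n / 2 ^ n

lemma PP_succ (n : ℕ) : PP (n + 1) = PP n + EE n / 2 := by
  have h := BB_main n n
  rw [show n + n + 1 = 2 * n + 1 by ring] at h
  unfold PP EE
  rw [pow_succ]
  field_simp
  linear_combination h

lemma PP_eq (k : ℕ) : PP (2 * k) = (∑ j ∈ Finset.range k, bb j * (-1) ^ j) / 2 := by
  induction k with
  | zero => simp [PP, BB, vv_zero]
  | succ k ih =>
    rw [show 2 * (k + 1) = 2 * k + 1 + 1 by ring, PP_succ, PP_succ, ih, (EE_even_odd k).1,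
      (EE_even_odd k).2, Finset.sum_range_succ]
    ring

lemma PP_odd (k : ℕ) : PP (2 * k + 1) = PP (2 * k + 2) := by
  rw [PP_succ (2 * k + 1), (EE_even_odd k).2]; simp

lemma fk_deriv (k : ℕ) (x : ℝ) : ∃ f' : ℝ,
    HasDerivAt (fun x : ℝ => ∑ j ∈ Finset.range (k + 1), bb j * (-x) ^ j) f' x ∧
    (∑ j ∈ Finset.range (k + 1), bb j * (-x) ^ j) + 2 * (1 + x) * f'
      = (2 * k + 2) * bb (k + 1) * (-x) ^ k := by
  induction k with
  | zero =>
    refine ⟨0, ?_, ?_⟩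
    · simpa using hasDerivAt_const x (bb 0)
    · have := bb_succ 0
      simp at this
      simp [this]
  | succ k ih =>
    obtain ⟨f', h1, h2⟩ := ih
    refine ⟨f' + bb (k + 1) * (((k + 1 : ℕ) : ℝ) * (-x) ^ k * (-1)), ?_, ?_⟩
    · simp only [Finset.sum_range_succ _ (k + 1)]
      refine h1.add (HasDerivAt.const_mul _ ?_)
      exact (hasDerivAt_neg x).pow (k + 1)
    · rw [Finset.sum_range_succ _ (k + 1)]
      have hb := bb_succ (k + 1)
      push_cast at hb ⊢
      rw [pow_succ (-x) k]
      linear_combination h2 - (-x) ^ k * (-x) * hb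

lemma series_bound (k : ℕ) :
    |Real.sqrt 2 * (∑ j ∈ Finset.range (k + 1), bb j * (-1) ^ j) - 1| ≤ bb (k + 1) := by
  choose f' h1 h2 using fk_deriv k
  set f : ℝ → ℝ := fun x => ∑ j ∈ Finset.range (k + 1), bb j * (-x) ^ j with hf
  have hg : ∀ x ∈ Set.Icc (0 : ℝ) 1, HasDerivAt (fun x => Real.sqrt (1 + x) * f x - 1)
      ((k + 1) * bb (k + 1) * (-x) ^ k / Real.sqrt (1 + x)) x := by
    intro x hx
    have hp : 0 < 1 + x := by linarith [hx.1]
    have hs : HasDerivAt (fun x => Real.sqrt (1 + x)) (1 / (2 * Real.sqrt (1 + x))) x :=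
      ((hasDerivAt_id' x).const_add 1).sqrt hp.ne'
    have hq : 0 < Real.sqrt (1 + x) := Real.sqrt_pos.2 hp
    have hsq := Real.sq_sqrt hp.le
    have h2x : f x + 2 * (1 + x) * f' x = (2 * k + 2) * bb (k + 1) * (-x) ^ k := h2 x
    have e : ((k : ℝ) + 1) * bb (k + 1) * (-x) ^ k
        = (f x + 2 * (Real.sqrt (1 + x)) ^ 2 * f' x) / 2 := by
      rw [hsq, h2x]; ring
    have e2 : ((k : ℝ) + 1) * bb (k + 1) * (-x) ^ k / Real.sqrt (1 + x)
        = 1 / (2 * Real.sqrt (1 + x)) * f x + Real.sqrt (1 + x) * f' x := by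
      rw [e]
      field_simp
    rw [e2]
    exact (hs.mul (h1 x)).sub_const 1
  have hB : ∀ x : ℝ, HasDerivAt (fun x => bb (k + 1) * x ^ (k + 1))
      (bb (k + 1) * ((k + 1 : ℕ) * x ^ k)) x := by
    intro x
    refine HasDerivAt.const_mul _ ?_
    simpa using hasDerivAt_pow (k + 1) x
  have key := image_norm_le_of_norm_deriv_right_le_deriv_boundary
    (f := fun x => Real.sqrt (1 + x) * f x - 1) (a := 0) (b := 1)
    (f' := fun x => (k + 1) * bb (k + 1) * (-x) ^ k / Real.sqrt (1 + x))
    (B := fun x => bb (k + 1) * x ^ (k + 1)) (B' := fun x => bb (k + 1) * ((k + 1 : ℕ) * x ^ k))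
    (fun x hx => (hg x hx).continuousAt.continuousWithinAt)
    (fun x hx => (hg x ⟨hx.1, hx.2.le⟩).hasDerivWithinAt)
    (by simp [hf, Finset.sum_range_succ', bb]) hB
    (by
      intro x hx
      have hx0 := hx.1
      have hb := bb_nonneg (k + 1)
      have hs : 1 ≤ Real.sqrt (1 + x) := Real.one_le_sqrt.2 (by linarith)
      rw [norm_div, norm_mul, norm_pow, norm_neg, Real.norm_of_nonneg hx0,
        Real.norm_of_nonneg (by positivity : 0 ≤ ((k : ℝ) + 1) * bb (k + 1)),
        Real.norm_of_nonneg (by positivity : 0 ≤ Real.sqrt (1 + x))]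
      refine (div_le_self (by positivity) hs).trans (le_of_eq ?_)
      push_cast; ring)
    (x := 1) ⟨zero_le_one, le_rfl⟩
  simp only [hf, Real.norm_eq_abs, one_pow, mul_one] at key
  norm_num at key
  exact key

lemma PP_bound (k : ℕ) :
    |PP (2 * k + 2) - 1 / (2 * Real.sqrt 2)| ≤ (1 / 2) / Real.sqrt (2 * k + 3) := by
  have h := series_bound k
  have hb := bb_le (k + 1)
  rw [show 2 * k + 2 = 2 * (k + 1) by ring, PP_eq]
  set s := ∑ j ∈ Finset.range (k + 1), bb j * (-1) ^ j
  have h2 : 1 ≤ Real.sqrt 2 := Real.one_le_sqrt.2 (by norm_num)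
  have e : s / 2 - 1 / (2 * Real.sqrt 2) = (Real.sqrt 2 * s - 1) / (2 * Real.sqrt 2) := by
    field_simp
  rw [e, abs_div, abs_of_pos (by positivity : 0 < 2 * Real.sqrt 2)]
  push_cast at hb
  rw [show 2 * ((k : ℝ) + 1) + 1 = 2 * k + 3 by ring] at hb
  calc _ ≤ |Real.sqrt 2 * s - 1| / 2 := by gcongr; linarith
    _ ≤ (1 / Real.sqrt (2 * k + 3)) / 2 := by gcongr; linarith
    _ = _ := by ring

lemma PP_tsum (n : ℕ) : ∑' x : ℤ, (a x ((n + 1 : ℕ) : ℤ)).re ^ 2 = PP n := by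
  simp only [a_re, tsum_div_const]
  simp only [PP, BB, sq]

/-- Probability of direction reversal:
`∑_{x ∈ ℤ} a₁(x,t)² = 1/(2√2) + O(1/√t)`. -/
theorem probability_of_direction_reversal :
    ∃ C > (0 : ℝ), ∀ t : ℤ, 1 ≤ t →
      |(∑' x : ℤ, (a x t).re ^ 2) - 1 / (2 * Real.sqrt 2)| ≤ C / Real.sqrt t := by
  refine ⟨1 / 2, by norm_num, fun t ht => ?_⟩
  obtain ⟨n, rfl⟩ : ∃ n : ℕ, t = ((n + 1 : ℕ) : ℤ) := ⟨(t - 1).toNat, by omega⟩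
  rw [PP_tsum]
  obtain ⟨k, rfl | rfl⟩ := Nat.even_or_odd' n
  · rcases k with _ | k
    · have h2 : 1 ≤ Real.sqrt 2 := Real.one_le_sqrt.2 (by norm_num)
      have : PP 0 = 0 := by simp [PP, BB, vv_zero]
      simp only [mul_zero, this, zero_sub, abs_neg]
      rw [abs_of_pos (by positivity)]
      norm_num
      rw [← one_div, div_le_one (by positivity)]
      exact h2
    · refine (PP_bound k).trans (le_of_eq ?_)
      push_cast
      congr 2; ring
  · rw [PP_odd]
    refine (PP_bound k).trans ?_
    push_cast
    apply div_le_div_of_nonneg_left (by norm_num) (Real.sqrt_pos.2 (by positivity))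
    apply Real.sqrt_le_sqrt
    linarith
end

section
/- For each t ∈ εℤ with t > 0, Σ_{x∈εℤ} a₁(x,t+ε,m,ε)² = Σ_{x∈εℤ} a₁(x,t,m,ε)² + (mε/√(1+m²ε²)) · a₁(0, 2t, m, ε). -/
open scoped BigOperators

/-- Feynman checkers amplitude with mass: `a(x·ε, t·ε, m, ε)` written in lattice
coordinates, i.e. `am m ε x t = (1+m²ε²)^((1-t)/2) * i * ∑ₛ (-i·m·ε)^turns(s)`. -/
noncomputable def am (m ε : ℝ) (x t : ℤ) : ℂ :=
  (Real.sqrt (1 + m ^ 2 * ε ^ 2) : ℂ) ^ (1 - t) * Complex.I *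
    ∑ d ∈ cpaths x t, (-Complex.I * (m * ε)) ^ nturns d

lemma nturns_succ {n : ℕ} (d : Fin (n + 1) → Bool) :
    nturns d = ∑ k : Fin n, (if d k.castSucc ≠ d k.succ then 1 else 0) := by
  induction n with
  | zero => simp [nturns]
  | succ n ih =>
    rw [Fin.sum_univ_succ]
    have h := ih (fun k => d k.succ)
    simp only [nturns] at h ⊢
    rw [List.ofFn_succ (f := d)]
    rw [List.ofFn_succ] at h ⊢
    simp only [List.tail_cons, List.zip_cons_cons, List.countP_cons] at h ⊢
    rw [h, add_comm]
    rcases hh : d 0 <;> rcases hh' : d 1 <;> simp [hh, hh']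

lemma nturns_snoc {n : ℕ} (d : Fin (n + 1) → Bool) (b : Bool) :
    nturns (Fin.snoc d b : Fin (n + 2) → Bool) =
      nturns d + (if d (Fin.last n) ≠ b then 1 else 0) := by
  rw [nturns_succ, nturns_succ, Fin.sum_univ_castSucc]
  congr 1
  · apply Finset.sum_congr rfl
    intro k _
    rw [← Fin.castSucc_succ, Fin.snoc_castSucc, Fin.snoc_castSucc]
  · rw [Fin.succ_last, Fin.snoc_castSucc, Fin.snoc_last]

lemma moveEndpoint_snoc {n : ℕ} (d : Fin n → Bool) (b : Bool) :
    moveEndpoint (Fin.snoc d b : Fin (n + 1) → Bool) =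
      moveEndpoint d + (if b then 1 else -1) := by
  simp [moveEndpoint, Fin.sum_univ_castSucc]

/-- Path sums with prescribed last move. -/
noncomputable def pathSum (z : ℂ) (n : ℕ) (b : Bool) (x : ℤ) : ℂ :=
  ∑ d : Fin (n + 1) → Bool,
    if moveEndpoint d = x ∧ d 0 = true ∧ d (Fin.last n) = b then z ^ nturns d else 0

lemma pathSum_succ (z : ℂ) (n : ℕ) (b : Bool) (x : ℤ) :
    pathSum z (n + 1) b x =
      pathSum z n b (x - (if b then 1 else -1)) +
        z * pathSum z n (!b) (x - (if b then 1 else -1)) := by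
  unfold pathSum
  rw [← (Fin.snocEquiv (fun _ : Fin (n + 2) => Bool)).sum_comp, Fintype.sum_prod_type,
    Finset.mul_sum, ← Finset.sum_add_distrib, Finset.sum_comm]
  apply Finset.sum_congr rfl
  intro d _
  have h0 : ∀ c : Bool, (Fin.snoc d c : Fin (n + 2) → Bool) 0 = d 0 := by
    intro c
    rw [← Fin.castSucc_zero, Fin.snoc_castSucc]
  have key : ∀ c : Bool, (Fin.snocEquiv (fun _ : Fin (n + 2) => Bool)) (c, d) =
    (Fin.snoc d c : Fin (n + 2) → Bool) := fun c => rfl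
  simp only [key, moveEndpoint_snoc, nturns_snoc, h0, Fin.snoc_last, Fintype.sum_bool,
    eq_sub_iff_add_eq]
  rcases hl : d (Fin.last n) <;> cases b <;> simp [pow_succ, mul_comm]

/-- The pair (real, imaginary) unnormalized amplitudes. -/
noncomputable def LR (u : ℝ) : ℕ → (ℤ → ℝ) × (ℤ → ℝ)
  | 0 => (fun _ => 0, fun x => if x = 1 then 1 else 0)
  | n + 1 => (fun x => (LR u n).1 (x + 1) + u * (LR u n).2 (x + 1),
      fun x => (LR u n).2 (x - 1) - u * (LR u n).1 (x - 1))

lemma pathSum_eq (u : ℝ) (n : ℕ) : ∀ x,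
    pathSum (-Complex.I * u) n true x = ((LR u n).2 x : ℂ) ∧
    pathSum (-Complex.I * u) n false x = -Complex.I * ((LR u n).1 x : ℂ) := by
  induction n with
  | zero =>
    intro x
    have e : ∀ f : (Fin 1 → Bool) → ℂ, ∑ d, f d = f (fun _ => true) + f (fun _ => false) := by
      intro f
      rw [← (Equiv.funUnique (Fin 1) Bool).symm.sum_comp, Fintype.sum_bool]
      rfl
    constructor
    · simp [pathSum, LR, e, moveEndpoint, nturns, eq_comm (a := x)]
      split_ifs <;> simp
    · simp [pathSum, LR, e]
  | succ n ih =>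
    intro x
    rw [pathSum_succ, pathSum_succ]
    simp only [if_true, Bool.not_true, Bool.not_false, (ih _).1, (ih _).2, LR]
    have := Complex.I_mul_I
    constructor
    · push_cast
      linear_combination (u : ℂ) * ((LR u n).1 (x - 1)) * this
    · simp [(ih _).1, (ih _).2]
      ring

lemma sum_cpaths (z : ℂ) (n : ℕ) (x t : ℤ) (h : t.toNat = n + 1) :
    ∑ d ∈ cpaths x t, z ^ nturns d = pathSum z n true x + pathSum z n false x := by
  unfold cpaths
  generalize t.toNat = k at h
  subst h
  unfold pathSum
  rw [Finset.sum_filter, ← Finset.sum_add_distrib]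
  apply Finset.sum_congr rfl
  intro d _
  rcases hl : d (Fin.last n) <;> simp [List.ofFn_succ]

lemma am_re (m ε : ℝ) (n : ℕ) (x t : ℤ) (h : t = n + 1) :
    (am m ε x t).re = Real.sqrt (1 + m ^ 2 * ε ^ 2) ^ (-(n : ℤ)) * (LR (m * ε) n).1 x := by
  unfold am
  have hz : (-Complex.I * (m * ε) : ℂ) = -Complex.I * ((m * ε : ℝ) : ℂ) := by push_cast; ring
  rw [hz, sum_cpaths _ n x t (by omega), (pathSum_eq _ _ _).1, (pathSum_eq _ _ _).2]
  have : (1 : ℤ) - t = -(n : ℤ) := by omega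
  rw [this, mul_assoc, ← Complex.ofReal_zpow, Complex.re_ofReal_mul]
  simp

lemma fin_shift {f : ℤ → ℝ} (hf : f.support.Finite) (c : ℤ) :
    (fun x => f (x + c)).support.Finite := by
  have := hf.preimage (f := fun x : ℤ => x + c) (add_left_injective c).injOn
  exact this

lemma LR_fin (u : ℝ) (n : ℕ) : (LR u n).1.support.Finite ∧ (LR u n).2.support.Finite := by
  induction n with
  | zero =>
    constructor
    · simp [LR]
    · apply (Set.finite_singleton (1 : ℤ)).subset
      intro x hx
      by_contra h
      simp only [Set.mem_singleton_iff] at h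
      simp [LR, h] at hx
  | succ n ih =>
    obtain ⟨h1, h2⟩ := ih
    constructor
    · apply ((fin_shift h1 1).union (fin_shift h2 1)).subset
      intro x hx
      by_contra h
      simp only [Set.mem_union, Function.mem_support, not_or, not_not] at h
      simp [LR, h.1, h.2] at hx
    · apply ((fin_shift h1 (-1)).union (fin_shift h2 (-1))).subset
      intro x hx
      by_contra h
      simp only [Set.mem_union, Function.mem_support, not_or, not_not, ← sub_eq_add_neg] at h
      simp [LR, h.1, h.2] at hx

lemma summ {f : ℤ → ℝ} (g : ℤ → ℝ) (hf : f.support.Finite) :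
    Summable (fun x => f x * g x) := by
  apply summable_of_hasFiniteSupport
  apply hf.subset
  intro x hx h
  simp [h] at hx

/-- The convolution form. -/
noncomputable def form (f g : ℤ → ℝ) : ℝ := ∑' x, f x * g x

lemma form_shift (f g : ℤ → ℝ) (c : ℤ) :
    form (fun x => f (x + c)) g = form f (fun x => g (x - c)) := by
  unfold form
  rw [← (Equiv.subRight c).tsum_eq]
  simp

lemma form_lin_left {f₁ f₂ : ℤ → ℝ} (g : ℤ → ℝ) (a b : ℝ) (h1 : f₁.support.Finite)
    (h2 : f₂.support.Finite) :
    form (fun x => a * f₁ x + b * f₂ x) g = a * form f₁ g + b * form f₂ g := by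
  unfold form
  rw [← tsum_mul_left, ← tsum_mul_left,
    ← ((summ g h1).mul_left a).tsum_add ((summ g h2).mul_left b)]
  exact tsum_congr fun x => by ring

lemma form_comm (f g : ℤ → ℝ) : form f g = form g f := tsum_congr fun x => mul_comm _ _

lemma form_lin_right (g : ℤ → ℝ) {f₁ f₂ : ℤ → ℝ} (a b : ℝ) (h1 : f₁.support.Finite)
    (h2 : f₂.support.Finite) :
    form g (fun x => a * f₁ x + b * f₂ x) = a * form g f₁ + b * form g f₂ := by
  rw [form_comm, form_lin_left g a b h1 h2, form_comm f₁, form_comm f₂]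

/-- The Huygens pairing. -/
noncomputable def huy (u : ℝ) (j k : ℕ) : ℝ :=
  u * (form (LR u j).2 (LR u k).2 - form (LR u j).1 (LR u k).1) +
    (form (LR u j).1 (LR u k).2 + form (LR u j).2 (LR u k).1)

lemma LR_fst (u : ℝ) (n : ℕ) : (LR u (n + 1)).1 =
    fun x => 1 * (fun y => (LR u n).1 (y + 1)) x + u * (fun y => (LR u n).2 (y + 1)) x := by
  funext x; simp [LR]

lemma LR_snd (u : ℝ) (n : ℕ) : (LR u (n + 1)).2 =
    fun x => 1 * (fun y => (LR u n).2 (y + -1)) x + (-u) * (fun y => (LR u n).1 (y + -1)) x := by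
  funext x; simp [LR]; ring_nf

lemma huy_step (u : ℝ) (j k : ℕ) : huy u (j + 1) k = huy u j (k + 1) := by
  unfold huy
  have hj := LR_fin u j
  have hk := LR_fin u k
  rw [LR_fst, LR_snd, LR_fst, LR_snd]
  rw [form_lin_left _ _ _ (fin_shift hj.1 1) (fin_shift hj.2 1),
    form_lin_left _ _ _ (fin_shift hj.1 1) (fin_shift hj.2 1),
    form_lin_left _ _ _ (fin_shift hj.2 (-1)) (fin_shift hj.1 (-1)),
    form_lin_left _ _ _ (fin_shift hj.2 (-1)) (fin_shift hj.1 (-1)),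
    form_lin_right _ _ _ (fin_shift hk.1 1) (fin_shift hk.2 1),
    form_lin_right _ _ _ (fin_shift hk.1 1) (fin_shift hk.2 1),
    form_lin_right _ _ _ (fin_shift hk.2 (-1)) (fin_shift hk.1 (-1)),
    form_lin_right _ _ _ (fin_shift hk.2 (-1)) (fin_shift hk.1 (-1))]
  simp only [form_shift, sub_neg_eq_add, sub_eq_add_neg]
  ring

lemma huy_zero (u : ℝ) (n : ℕ) : huy u n 0 = (LR u (n + 1)).1 0 := by
  have h : ∀ f : ℤ → ℝ, form f (LR u 0).2 = f 1 := by
    intro f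
    simp [form, LR]
  have h' : ∀ f : ℤ → ℝ, form f (LR u 0).1 = 0 := by
    intro f
    simp [form, LR]
  rw [huy, h, h, h', h']
  simp [LR]
  ring

lemma huy_eq (u : ℝ) (k : ℕ) : ∀ j, huy u j k = (LR u (j + k + 1)).1 0 := by
  induction k with
  | zero => exact huy_zero u
  | succ k ih =>
    intro j
    rw [← huy_step, ih]
    rw [show j + 1 + k + 1 = j + (k + 1) + 1 by omega]

lemma form_step (u : ℝ) (n : ℕ) :
    form (LR u (n + 1)).1 (LR u (n + 1)).1 =
      (1 + u ^ 2) * form (LR u n).1 (LR u n).1 + u * (LR u (n + n + 1)).1 0 := by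
  have hj := LR_fin u n
  rw [← huy_eq, huy, LR_fst]
  rw [form_lin_left _ _ _ (fin_shift hj.1 1) (fin_shift hj.2 1),
    form_lin_right _ _ _ (fin_shift hj.1 1) (fin_shift hj.2 1),
    form_lin_right _ _ _ (fin_shift hj.1 1) (fin_shift hj.2 1)]
  simp only [form_shift, sub_add_cancel]
  rw [form_comm (LR u n).2 (LR u n).1]
  ring

/-- For each `t ∈ εℤ`, `t > 0`:
`∑_{x∈εℤ} a₁(x,t+ε,m,ε)² = ∑_{x∈εℤ} a₁(x,t,m,ε)² + (mε/√(1+m²ε²)) a₁(0,2t,m,ε)`. -/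
theorem sum_a1_sq_step (m ε : ℝ) (hε : 0 < ε) (hm : 0 ≤ m) (t : ℤ) (ht : 0 < t) :
    ∑' x : ℤ, (am m ε x (t + 1)).re ^ 2 =
      (∑' x : ℤ, (am m ε x t).re ^ 2) +
        m * ε / Real.sqrt (1 + m ^ 2 * ε ^ 2) * (am m ε 0 (2 * t)).re := by
  obtain ⟨n, rfl⟩ : ∃ n : ℕ, t = n + 1 := ⟨(t - 1).toNat, by omega⟩
  have e : 1 + m ^ 2 * ε ^ 2 = 1 + (m * ε) ^ 2 := by ring
  have hs : ∀ (k : ℕ) (t : ℤ), t = k + 1 → ∑' x : ℤ, (am m ε x t).re ^ 2 =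
      (Real.sqrt (1 + m ^ 2 * ε ^ 2) ^ (-(k : ℤ))) ^ 2 *
        form (LR (m * ε) k).1 (LR (m * ε) k).1 := by
    intro k t h
    rw [form, ← tsum_mul_left]
    exact tsum_congr fun x => by rw [am_re m ε k x t h]; ring
  rw [hs (n + 1) _ (by push_cast; ring), hs n _ rfl, form_step,
    am_re m ε (n + n + 1) 0 _ (by push_cast; ring)]
  have hpos : 0 < 1 + m ^ 2 * ε ^ 2 := by positivity
  have hq := Real.sq_sqrt hpos.le
  have hq0 := Real.sqrt_pos.mpr hpos
  rw [e] at *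
  generalize Real.sqrt (1 + (m * ε) ^ 2) = q at *
  rw [← hq]
  simp only [zpow_neg, zpow_natCast]
  field_simp
  ring
end
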